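/- arXiv:1205.1735 — 2 statements merged into one kernel-verified Lean document; each statement's English description precedes it below -/
import Mathlib

section
/- For all real numbers a, b, c, d one has |e^{ia} − e^{ib} − e^{ic} + e^{id}| ≤ |(a−b) − (c−d)| (1 + |b−d| + |c−d|) + |b−d| · |c−d|. -/
open MeasureTheory Filter Topology
open scoped ENNReal NNReal

noncomputable section

abbrev Euc (d : ℕ) : Type := EuclideanSpace ℝ (Fin d)

/-- `Y^w_{s,t}(ω,ξ) = ∫_s^t exp(i ξ·w_u + i ω u) du`. -/
def Yint {d : ℕ} (w : ℝ → Euc d) (s t ω : ℝ) (ξ : Euc d) : ℂ :=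
  ∫ u in s..t, Complex.exp (Complex.I * Complex.ofReal (inner ℝ ξ (w u) + ω * u))

/-- The averaging constant `K^w_{α,γ}`. -/
def avgK {d : ℕ} (w : ℝ → Euc d) (α γ : ℝ) : ℝ≥0∞ :=
  ⨆ (s : ℝ) (t : ℝ) (_ : 0 ≤ s) (_ : s < t) (_ : t ≤ 1) (ω : ℝ) (ξ : Euc d),
    ENNReal.ofReal (‖Yint w s t ω ξ‖ /
      ((1 + ‖ξ‖) ^ α * (1 + Real.sqrt (Real.log (1 + |ω|))) * (t - s) ^ γ))

/-- The norm `N_α` of a space-time vector field given through its Fourier transform `bhat`. -/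
def FLnorm (d : ℕ) (α : ℝ) (bhat : ℝ × Euc d → Fin d → ℂ) : ℝ≥0∞ :=
  ∫⁻ p : ℝ × Euc d, ENNReal.ofReal (‖bhat p‖ * (1 + ‖p.2‖) ^ α *
    (1 + Real.sqrt (Real.log (1 + |p.1|))))

/-- The vector field `b(t,x)` recovered from its space-time Fourier transform. -/
def fieldOf {d : ℕ} (bhat : ℝ × Euc d → Fin d → ℂ) (t : ℝ) (x : Euc d) : Euc d :=
  (EuclideanSpace.equiv (Fin d) ℝ).symm fun i =>
    ∫ p : ℝ × Euc d, (bhat p i * Complex.exp (Complex.I * Complex.ofReal (p.1 * t + inner ℝ p.2 x))).re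

/-- The averaged vector field `σ^w_{[s,t]} b`, defined through the Fourier representation. -/
def sigmaAvg {d : ℕ} (w : ℝ → Euc d) (bhat : ℝ × Euc d → Fin d → ℂ) (s t : ℝ) (x : Euc d) :
    Euc d :=
  (EuclideanSpace.equiv (Fin d) ℝ).symm fun i =>
    ∫ p : ℝ × Euc d, (bhat p i * Yint w s t p.1 p.2 *
      Complex.exp (Complex.I * Complex.ofReal (inner ℝ p.2 x))).re

/-- Partitions of the interval `[s,t]`. -/
structure IccPartition (s t : ℝ) where
  n : ℕ
  pts : ℕ → ℝ
  first : pts 0 = s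
  last : pts n = t
  mono : ∀ i, i < n → pts i ≤ pts (i + 1)

/-- The mesh of the partition is smaller than `δ`. -/
def IccPartition.MeshLt {s t : ℝ} (P : IccPartition s t) (δ : ℝ) : Prop :=
  ∀ i, i < P.n → P.pts (i + 1) - P.pts i < δ

/-- Riemann sums `Σ_i (G_{t_{i+1}} - G_{t_i})(f_{t_i})` of the nonlinear Young integral. -/
def RiemannSum {V W : Type*} [AddCommGroup W] (G : ℝ → V → W) (f : ℝ → V)
    {s t : ℝ} (P : IccPartition s t) : W :=
  ∑ i ∈ Finset.range P.n, (G (P.pts (i + 1)) (f (P.pts i)) - G (P.pts i) (f (P.pts i)))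

/-- `L` is the nonlinear Young integral `∫_s^t G_{du}(f_u)`: the Riemann sums converge to `L`
as the mesh of the partition tends to `0`. -/
def HasYoungIntegral {V W : Type*} [NormedAddCommGroup W] (G : ℝ → V → W) (f : ℝ → V)
    (s t : ℝ) (L : W) : Prop :=
  ∀ ε > 0, ∃ δ > 0, ∀ P : IccPartition s t, P.MeshLt δ → ‖RiemannSum G f P - L‖ < ε

/-- Riemann sums `Σ_i (σ^w_{[t_i,t_{i+1}]} b)(θ_{t_i})`. -/
def sigmaRiemannSum {d : ℕ} (w : ℝ → Euc d) (bhat : ℝ × Euc d → Fin d → ℂ)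
    (θ : ℝ → Euc d) {s t : ℝ} (P : IccPartition s t) : Euc d :=
  ∑ i ∈ Finset.range P.n, sigmaAvg w bhat (P.pts i) (P.pts (i + 1)) (θ (P.pts i))

/-- `L = ∫_s^t (σ^w_{du} b)(θ_u)` as a limit of Riemann sums. -/
def HasSigmaIntegral {d : ℕ} (w : ℝ → Euc d) (bhat : ℝ × Euc d → Fin d → ℂ)
    (θ : ℝ → Euc d) (s t : ℝ) (L : Euc d) : Prop :=
  ∀ ε > 0, ∃ δ > 0, ∀ P : IccPartition s t, P.MeshLt δ → ‖sigmaRiemannSum w bhat θ P - L‖ < ε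

/-- `θ` solves the Young equation `θ_t = x₀ + ∫_0^t (σ^w_{du} b)(θ_u)` on `[0,1]`. -/
def SolvesSigmaYoung {d : ℕ} (w : ℝ → Euc d) (bhat : ℝ × Euc d → Fin d → ℂ)
    (x₀ : Euc d) (θ : ℝ → Euc d) : Prop :=
  θ 0 = x₀ ∧ ∀ t ∈ Set.Icc (0 : ℝ) 1, HasSigmaIntegral w bhat θ 0 t (θ t - x₀)

/-- `γ`-Hölder continuity on `[0,1]`. -/
def HolderOnIcc {E : Type*} [NormedAddCommGroup E] (γ : ℝ) (f : ℝ → E) : Prop :=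
  ∃ C : ℝ, ∀ s ∈ Set.Icc (0 : ℝ) 1, ∀ t ∈ Set.Icc (0 : ℝ) 1, ‖f t - f s‖ ≤ C * |t - s| ^ γ

/-- Covariance of the fractional Brownian motion of Hurst index `H`. -/
def fbmCov (H : ℝ) (s t : ℝ) : ℝ := (s ^ (2 * H) + t ^ (2 * H) - |t - s| ^ (2 * H)) / 2

/-- `W` is a `d`-dimensional fractional Brownian motion of Hurst parameter `H` with continuous
sample paths: the coordinates are independent centered Gaussian processes with the fBm
covariance, expressed by asking every finite linear combination to be Gaussian. -/
def IsFBM {Ω : Type*} [MeasureSpace Ω] (d : ℕ) (H : ℝ) (W : Ω → ℝ → Euc d) : Prop :=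
  (∀ ω, ContinuousOn (W ω) (Set.Icc 0 1)) ∧
  (∀ t, Measurable fun ω => W ω t) ∧
  (∀ ω, W ω 0 = 0) ∧
  ∀ (n : ℕ) (c : Fin n → ℝ) (t : Fin n → ℝ) (j : Fin n → Fin d),
    (∀ k, t k ∈ Set.Icc (0 : ℝ) 1) →
    Measure.map (fun ω => ∑ k, c k * W ω (t k) (j k)) (volume : Measure Ω) =
      ProbabilityTheory.gaussianReal 0
        (Real.toNNReal (∑ k, ∑ l, c k * c l *
          (if j k = j l then fbmCov H (t k) (t l) else 0)))

/-- `R^w_λ = (∫_0^1 exp(λ |w_u|²) du)^{1/λ}`. -/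
def Rconst {d : ℕ} (lam : ℝ) (w : ℝ → Euc d) : ℝ≥0∞ :=
  (∫⁻ u in Set.Icc (0 : ℝ) 1, ENNReal.ofReal (Real.exp (lam * ‖w u‖ ^ 2))) ^ (1 / lam)

/-- `S^w_λ`. -/
def Sconst {d : ℕ} (H lam : ℝ) (w : ℝ → Euc d) : ℝ≥0∞ :=
  (∑' n : ℕ, ∑' m : ℕ, ∑ k ∈ Finset.range (2 ^ n), ∑' q : ℤ × (Fin d → ℤ),
    ENNReal.ofReal (
      (2 : ℝ) ^ (-(2 * (n : ℝ)) - (m : ℝ) * ((d : ℝ) + 2)) *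
      (1 + |(q.1 : ℝ) / 2 ^ m|) ^ (-(2 : ℝ)) *
      (1 + ‖(EuclideanSpace.equiv (Fin d) ℝ).symm (fun i => (q.2 i : ℝ) / 2 ^ m)‖) ^
        (-((d : ℝ) + 1)) *
      Real.exp (lam * 2 ^ n *
        (1 + ‖(EuclideanSpace.equiv (Fin d) ℝ).symm (fun i => (q.2 i : ℝ) / 2 ^ m)‖) ^ (1 / H) *
        ‖Yint w ((k : ℝ) / 2 ^ n) (((k : ℝ) + 1) / 2 ^ n) ((q.1 : ℝ) / 2 ^ m)
          ((EuclideanSpace.equiv (Fin d) ℝ).symm (fun i => (q.2 i : ℝ) / 2 ^ m))‖ ^ 2))) ^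
  (1 / lam)

/-- `Q^w_λ = √(log S^w_λ) + √(log R^w_λ)`. -/
def Qconst {d : ℕ} (H lam : ℝ) (w : ℝ → Euc d) : ℝ :=
  Real.sqrt (Real.log (Sconst H lam w).toReal) + Real.sqrt (Real.log (Rconst lam w).toReal)

/-- The four-point estimate for complex exponentials:
`|e^{ia} − e^{ib} − e^{ic} + e^{id}| ≤ |(a−b)−(c−d)| (1+|b−d|+|c−d|) + |b−d||c−d|`. -/
theorem statement4 (a b c d : ℝ) :
    ‖Complex.exp (Complex.I * a) - Complex.exp (Complex.I * b) -
        Complex.exp (Complex.I * c) + Complex.exp (Complex.I * d)‖ ≤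
      |a - b - (c - d)| * (1 + |b - d| + |c - d|) + |b - d| * |c - d| := by
  have bound (x : ℝ) : ‖Complex.exp (Complex.I * x) - 1‖ ≤ |x| :=
    Real.norm_exp_I_mul_ofReal_sub_one_le
  have factor : Complex.exp (Complex.I * a) - Complex.exp (Complex.I * b) -
        Complex.exp (Complex.I * c) + Complex.exp (Complex.I * d) =
      Complex.exp (Complex.I * (b + c - d : ℝ)) *
          (Complex.exp (Complex.I * (a - b - (c - d) : ℝ)) - 1) +
        Complex.exp (Complex.I * d) * ((Complex.exp (Complex.I * (b - d : ℝ)) - 1) *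
          (Complex.exp (Complex.I * (c - d : ℝ)) - 1)) := by
    simp only [mul_sub, sub_mul, mul_one, one_mul, ← Complex.exp_add]
    push_cast
    ring_nf
  rw [factor]
  calc
    _ ≤ |a - b - (c - d)| + |b - d| * |c - d| := by
      refine (norm_add_le _ _).trans ?_
      simp only [norm_mul, Complex.norm_exp_I_mul_ofReal, one_mul]
      gcongr <;> apply bound
    _ ≤ _ := by
      gcongr
      exact le_mul_of_one_le_right (abs_nonneg _)
        (by linarith [abs_nonneg (b - d), abs_nonneg (c - d)])
end
end

section
/- There is a universal constant C such that for every α ∈ ℝ, every b ∈ FL^{α+2} and all x₁, x₂, y₁, y₂ ∈ ℝ^d: N_α(τ_{x₁}b − τ_{y₁}b − τ_{x₂}b + τ_{y₂}b) ≤ C N_{α+2}(b) [ |(x₁−y₁) − (x₂−y₂)| (1 + |y₁−y₂| + |x₂−y₂|) + |y₁−y₂| · |x₂−y₂| ]. -/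
open MeasureTheory Filter Topology
open scoped ENNReal NNReal

noncomputable section

/-- The map `a ↦ exp (i a)` is `1`-Lipschitz. -/
theorem norm_exp_I_mul_ofReal_sub_exp_I_mul_ofReal_le (a b : ℝ) :
    ‖Complex.exp (Complex.I * (a : ℂ)) - Complex.exp (Complex.I * (b : ℂ))‖ ≤ |a - b| := by
  have h : Complex.exp (Complex.I * (a : ℂ)) - Complex.exp (Complex.I * (b : ℂ)) =
      Complex.exp (Complex.I * (b : ℂ)) * (Complex.exp (Complex.I * ((a - b : ℝ) : ℂ)) - 1) := by
    rw [mul_sub, ← Complex.exp_add, mul_one]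
    congr 2
    push_cast
    ring
  rw [h, norm_mul, Complex.norm_exp_I_mul_ofReal, one_mul]
  exact Real.norm_exp_I_mul_ofReal_sub_one_le

/-- Four-point estimate for the map `a ↦ exp (i a)`. -/
theorem norm_exp_I_mul_ofReal_four_point_le (a₁ b₁ a₂ b₂ : ℝ) :
    ‖Complex.exp (Complex.I * (a₁ : ℂ)) - Complex.exp (Complex.I * (b₁ : ℂ)) -
        Complex.exp (Complex.I * (a₂ : ℂ)) + Complex.exp (Complex.I * (b₂ : ℂ))‖ ≤
      |a₁ - b₁ - (a₂ - b₂)| + |b₁ - b₂| * |a₂ - b₂| := by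
  have key (a b : ℝ) : Complex.exp (Complex.I * (a : ℂ)) =
      Complex.exp (Complex.I * (b : ℂ)) * Complex.exp (Complex.I * ((a - b : ℝ) : ℂ)) := by
    rw [← Complex.exp_add]
    congr 1
    push_cast
    ring
  have h : Complex.exp (Complex.I * (a₁ : ℂ)) - Complex.exp (Complex.I * (b₁ : ℂ)) -
        Complex.exp (Complex.I * (a₂ : ℂ)) + Complex.exp (Complex.I * (b₂ : ℂ)) =
      Complex.exp (Complex.I * (b₁ : ℂ)) * (Complex.exp (Complex.I * ((a₁ - b₁ : ℝ) : ℂ)) -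
          Complex.exp (Complex.I * ((a₂ - b₂ : ℝ) : ℂ))) +
        (Complex.exp (Complex.I * (b₁ : ℂ)) - Complex.exp (Complex.I * (b₂ : ℂ))) *
          (Complex.exp (Complex.I * ((a₂ - b₂ : ℝ) : ℂ)) - 1) := by
    rw [key a₁ b₁, key a₂ b₂]
    ring
  rw [h]
  refine (norm_add_le _ _).trans ?_
  rw [norm_mul, norm_mul, Complex.norm_exp_I_mul_ofReal, one_mul]
  gcongr
  · exact norm_exp_I_mul_ofReal_sub_exp_I_mul_ofReal_le _ _
  · exact norm_exp_I_mul_ofReal_sub_exp_I_mul_ofReal_le _ _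
  · exact Real.norm_exp_I_mul_ofReal_sub_one_le

/-- Four-point estimate for the characters `x ↦ exp (i ⟨ξ, x⟩)`. -/
theorem norm_exp_I_mul_inner_four_point_le {E : Type*} [NormedAddCommGroup E]
    [InnerProductSpace ℝ E] (ξ x₁ x₂ y₁ y₂ : E) :
    ‖Complex.exp (Complex.I * Complex.ofReal (inner ℝ ξ x₁)) -
        Complex.exp (Complex.I * Complex.ofReal (inner ℝ ξ y₁)) -
        Complex.exp (Complex.I * Complex.ofReal (inner ℝ ξ x₂)) +
        Complex.exp (Complex.I * Complex.ofReal (inner ℝ ξ y₂))‖ ≤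
      (1 + ‖ξ‖) ^ 2 * (‖x₁ - y₁ - (x₂ - y₂)‖ * (1 + ‖y₁ - y₂‖ + ‖x₂ - y₂‖) +
        ‖y₁ - y₂‖ * ‖x₂ - y₂‖) := by
  refine (norm_exp_I_mul_ofReal_four_point_le _ _ _ _).trans ?_
  simp only [← inner_sub_right]
  calc |inner ℝ ξ (x₁ - y₁ - (x₂ - y₂))| + |inner ℝ ξ (y₁ - y₂)| * |inner ℝ ξ (x₂ - y₂)|
      ≤ ‖ξ‖ * ‖x₁ - y₁ - (x₂ - y₂)‖ + (‖ξ‖ * ‖y₁ - y₂‖) * (‖ξ‖ * ‖x₂ - y₂‖) := by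
        gcongr <;> exact abs_real_inner_le_norm _ _
    _ = ‖ξ‖ * (‖x₁ - y₁ - (x₂ - y₂)‖ * 1) + ‖ξ‖ ^ 2 * (‖y₁ - y₂‖ * ‖x₂ - y₂‖) := by ring
    _ ≤ (1 + ‖ξ‖) ^ 2 * (‖x₁ - y₁ - (x₂ - y₂)‖ * (1 + ‖y₁ - y₂‖ + ‖x₂ - y₂‖)) +
          (1 + ‖ξ‖) ^ 2 * (‖y₁ - y₂‖ * ‖x₂ - y₂‖) := by
        have hξ := norm_nonneg ξ
        gcongr
        · nlinarith
        · linarith [norm_nonneg (y₁ - y₂), norm_nonneg (x₂ - y₂)]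
        · linarith
    _ = _ := by ring

/-- Four-point estimate for translations: for a universal constant `C`,
`N_α(τ_{x₁}b − τ_{y₁}b − τ_{x₂}b + τ_{y₂}b) ≤ C N_{α+2}(b)
[ |(x₁−y₁)−(x₂−y₂)| (1+|y₁−y₂|+|x₂−y₂|) + |y₁−y₂||x₂−y₂| ]`. -/
theorem statement6 :
    ∃ C : ℝ, 0 < C ∧ ∀ (d : ℕ) (α : ℝ) (bhat : ℝ × Euc d → Fin d → ℂ),
      FLnorm d (α + 2) bhat < ⊤ →
      ∀ x₁ x₂ y₁ y₂ : Euc d,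
      FLnorm d α (fun p =>
          Complex.exp (Complex.I * Complex.ofReal (inner ℝ p.2 x₁)) • bhat p -
          Complex.exp (Complex.I * Complex.ofReal (inner ℝ p.2 y₁)) • bhat p -
          Complex.exp (Complex.I * Complex.ofReal (inner ℝ p.2 x₂)) • bhat p +
          Complex.exp (Complex.I * Complex.ofReal (inner ℝ p.2 y₂)) • bhat p) ≤
        ENNReal.ofReal C * FLnorm d (α + 2) bhat *
          ENNReal.ofReal (‖x₁ - y₁ - (x₂ - y₂)‖ * (1 + ‖y₁ - y₂‖ + ‖x₂ - y₂‖) +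
            ‖y₁ - y₂‖ * ‖x₂ - y₂‖) := by
  refine ⟨1, one_pos, fun d α bhat _ x₁ x₂ y₁ y₂ => ?_⟩
  rw [ENNReal.ofReal_one, one_mul, mul_comm]
  unfold FLnorm
  rw [← lintegral_const_mul' _ _ ENNReal.ofReal_ne_top]
  refine lintegral_mono fun p => ?_
  rw [← ENNReal.ofReal_mul (by positivity)]
  refine ENNReal.ofReal_le_ofReal ?_
  beta_reduce
  have hp : 0 < 1 + ‖p.2‖ := by positivity
  rw [Real.rpow_add hp, Real.rpow_two, ← sub_smul, ← sub_smul, ← add_smul, norm_smul]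
  calc _ ≤ (1 + ‖p.2‖) ^ 2 * (‖x₁ - y₁ - (x₂ - y₂)‖ * (1 + ‖y₁ - y₂‖ + ‖x₂ - y₂‖) +
          ‖y₁ - y₂‖ * ‖x₂ - y₂‖) * ‖bhat p‖ * (1 + ‖p.2‖) ^ α *
          (1 + Real.sqrt (Real.log (1 + |p.1|))) := by
        gcongr
        exact norm_exp_I_mul_inner_four_point_le _ _ _ _ _
    _ = _ := by ring
end
end
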